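/- Let k be a positive integer. If two virtual knots K and K' are related by a finite sequence of 2k-moves, then J_n(K) − J_n(K') = J_{−n}(K) − J_{−n}(K') for every nonzero integer n; in particular, Σ_{n>0} |J_n(K) − J_n(K')| = Σ_{n<0} |J_n(K) − J_n(K')|. -/

import Mathlib

/-!
Combinatorial Gauss diagrams.

A Gauss diagram is encoded as a list of chord endpoints read along the
oriented circle from a basepoint.  Each endpoint records the (natural number)
label of its chord, whether it is the terminal endpoint of the (oriented)
chord, and the sign of the chord (`true` = +1, `false` = -1).
Diagrams are considered up to rotation of the basepoint and relabeling of the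
chords; these renamings are included among the "Reidemeister" generators.
-/

structure Endpoint where
  label : ℕ
  isTerminal : Bool
  sign : Bool
deriving DecidableEq

namespace Gauss

/-- The sign (±1) of the chord through an endpoint. -/
def signValue (e : Endpoint) : ℤ := if e.sign then 1 else -1

/-- The sign assigned to an endpoint: `ε` at the terminal endpoint and `-ε`
at the initial endpoint of a chord of sign `ε`. -/
def endpointValue (e : Endpoint) : ℤ := if e.isTerminal then signValue e else -signValue e

/-- The list of chord labels of the endpoints of a word. -/
def labels (L : List Endpoint) : List ℕ := L.map Endpoint.label

/-- A word is a Gauss diagram when every chord label occurring in it occurs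
exactly twice, once as an initial and once as a terminal endpoint, with the
same sign at both occurrences. -/
def IsGaussDiagram (L : List Endpoint) : Prop :=
  ∀ e ∈ L, (L.filter (fun x => x.label == e.label)).length = 2 ∧
    ∃ e' ∈ L, e'.label = e.label ∧ e'.isTerminal = !e.isTerminal ∧ e'.sign = e.sign

/-- Rotate a word so that the first endpoint satisfying `p` comes first. -/
def rotateTo (L : List Endpoint) (p : Endpoint → Bool) : List Endpoint :=
  match L.findIdx? p with
  | some i => L.drop i ++ L.take i
  | none => L

/-- The index of the chord labeled `c`: the sum of the signs assigned to the
endpoints on the arc running from the initial endpoint of the chord to its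
terminal endpoint in the direction of the circle's orientation. -/
def chordIndex (L : List Endpoint) (c : ℕ) : ℤ :=
  ((((rotateTo L (fun e => e.label == c && !e.isTerminal)).drop 1).takeWhile
      (fun e => e.label != c)).map endpointValue).sum

/-- `Jn L n`: the sum of the signs of the chords of `L` of index `n`. -/
def Jn (L : List Endpoint) (n : ℤ) : ℤ :=
  ((L.filter (fun e => e.isTerminal && decide (chordIndex L e.label = n))).map signValue).sum

/-- The odd writhe: the sum of the signs of the chords of odd index,
i.e. `J = Σ_{n odd} J_n`. -/
def oddWrithe (L : List Endpoint) : ℤ :=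
  ((L.filter (fun e => e.isTerminal && decide (chordIndex L e.label % 2 ≠ 0))).map signValue).sum

/-- Moving the basepoint of the circle. -/
def rotateStep (L L' : List Endpoint) : Prop :=
  ∃ x xs, L = x :: xs ∧ L' = xs ++ [x]

/-- Injective relabeling of the chords. -/
def relabelStep (L L' : List Endpoint) : Prop :=
  ∃ f : ℕ → ℕ, Function.Injective f ∧
    L' = L.map (fun e => Endpoint.mk (f e.label) e.isTerminal e.sign)

/-- Reidemeister move I (removal direction): remove an isolated chord whose
two endpoints are adjacent (either orientation, either sign). -/
def reid1 (L L' : List Endpoint) : Prop :=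
  ∃ (A B : List Endpoint) (c : ℕ) (t s : Bool),
    c ∉ labels (A ++ B) ∧
    L = A ++ [Endpoint.mk c t s, Endpoint.mk c (!t) s] ++ B ∧
    L' = A ++ B

/-- Reidemeister move II (removal direction): remove two chords of opposite
signs whose initial endpoints are adjacent and whose terminal endpoints are
adjacent (in either of the two admissible orders). -/
def reid2 (L L' : List Endpoint) : Prop :=
  ∃ (A B C : List Endpoint) (c d : ℕ) (s crossed : Bool),
    c ≠ d ∧ c ∉ labels (A ++ B ++ C) ∧ d ∉ labels (A ++ B ++ C) ∧
    L = A ++ [Endpoint.mk c false s, Endpoint.mk d false (!s)] ++ B ++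
        (if crossed then [Endpoint.mk c true s, Endpoint.mk d true (!s)]
         else [Endpoint.mk d true (!s), Endpoint.mk c true s]) ++ C ∧
    L' = A ++ B ++ C

/-- Reidemeister move III (a standard variant; together with the moves I, II,
rotations and relabelings it generates all versions of the third move). -/
def reid3 (L L' : List Endpoint) : Prop :=
  ∃ (A B C D : List Endpoint) (a b c : ℕ) (s : Bool),
    a ≠ b ∧ b ≠ c ∧ a ≠ c ∧
    L = A ++ [Endpoint.mk b false s, Endpoint.mk a false s] ++ B ++
        [Endpoint.mk a true s, Endpoint.mk c false (!s)] ++ C ++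
        [Endpoint.mk b true s, Endpoint.mk c true (!s)] ++ D ∧
    L' = A ++ [Endpoint.mk a false s, Endpoint.mk b false s] ++ B ++
        [Endpoint.mk c false (!s), Endpoint.mk a true s] ++ C ++
        [Endpoint.mk c true (!s), Endpoint.mk b true s] ++ D

/-- A single Reidemeister generator (including diagram renamings). -/
def reidStep (L L' : List Endpoint) : Prop :=
  rotateStep L L' ∨ relabelStep L L' ∨ reid1 L L' ∨ reid2 L L' ∨ reid3 L L'

/-- A Ξ-move: exchange the first and third of three consecutive endpoints
belonging to three distinct chords, keeping all signs and orientations. -/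
def xiStep (L L' : List Endpoint) : Prop :=
  ∃ (A B : List Endpoint) (x y z : Endpoint),
    x.label ≠ y.label ∧ y.label ≠ z.label ∧ x.label ≠ z.label ∧
    L = A ++ [x, y, z] ++ B ∧
    L' = A ++ [z, y, x] ++ B

/-- A 2k-move (removal direction): remove `2k` chords `c 0, …, c (2k-1)`, all
of sign `s`, whose `p`-endpoints appear consecutively on one arc and whose
`q`-endpoints appear consecutively on a disjoint arc, the chord `c i` being
oriented from `p` to `q` for even `i` (the paper's odd `i`, 1-indexed) and
from `q` to `p` for odd `i`, so initial and terminal endpoints alternate. -/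
def move2k (k : ℕ) (L L' : List Endpoint) : Prop :=
  ∃ (A B C : List Endpoint) (c : ℕ → ℕ) (s : Bool),
    (∀ i < 2 * k, ∀ j < 2 * k, c i = c j → i = j) ∧
    (∀ i < 2 * k, c i ∉ labels (A ++ B ++ C)) ∧
    L = A ++ (List.range (2 * k)).map (fun i => Endpoint.mk (c i) (decide (i % 2 = 1)) s)
          ++ B ++
        (List.range (2 * k)).map (fun i => Endpoint.mk (c i) (decide (i % 2 = 0)) s)
          ++ C ∧
    L' = A ++ B ++ C

/-- A crossing change: reverse the sign and the orientation of one chord. -/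
def crossingChange (L L' : List Endpoint) : Prop :=
  ∃ c : ℕ,
    L' = L.map (fun e =>
      if e.label = c then Endpoint.mk e.label (!e.isTerminal) (!e.sign) else e)

/-- Finite sequences of moves from `r`, performed in either direction. -/
def Moves (r : List Endpoint → List Endpoint → Prop) :
    List Endpoint → List Endpoint → Prop :=
  Relation.ReflTransGen (fun L L' => r L L' ∨ r L' L)

/-- Related by Reidemeister moves: the two words represent the same virtual knot. -/
def ReidEquiv : List Endpoint → List Endpoint → Prop := Moves reidStep

/-- Related by a finite sequence of 2k-moves (and Reidemeister moves). -/
def Rel2k (k : ℕ) : List Endpoint → List Endpoint → Prop :=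
  Moves (fun L L' => reidStep L L' ∨ move2k k L L')

/-- Related by a finite sequence of Ξ-moves (and Reidemeister moves). -/
def RelXi : List Endpoint → List Endpoint → Prop :=
  Moves (fun L L' => reidStep L L' ∨ xiStep L L')

/-- Related by a finite sequence of 2k-moves and Ξ-moves (and Reidemeister moves). -/
def Rel2kXi (k : ℕ) : List Endpoint → List Endpoint → Prop :=
  Moves (fun L L' => reidStep L L' ∨ move2k k L L' ∨ xiStep L L')

/-- Related by a finite sequence of crossing changes and Ξ-moves
(and Reidemeister moves). -/
def RelCCXi : List Endpoint → List Endpoint → Prop :=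
  Moves (fun L L' => reidStep L L' ∨ crossingChange L L' ∨ xiStep L L')

/-- A shell-pair of sign `s`: two chords `c`, `d` of sign `s` whose four
endpoints are consecutive, interleaved as 1st-3rd and 2nd-4th
(with arbitrary orientations `t`, `u` of the two shells). -/
def shellPair (c d : ℕ) (t u s : Bool) : List Endpoint :=
  [Endpoint.mk c t s, Endpoint.mk d u s, Endpoint.mk c (!t) s, Endpoint.mk d (!u) s]

/-- The Gauss diagram `G(a)`: `|a|` consecutive shell-pairs of sign `+1` if
`a > 0` and of sign `-1` if `a < 0`; `G(0)` has no chords.  It represents the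
virtual knot `K(a)`. -/
def Gword (a : ℤ) : List Endpoint :=
  ((List.range a.natAbs).map
    (fun j => shellPair (2 * j) (2 * j + 1) false false (decide (0 < a)))).flatten

/-- `Rel2kCount k m G G'`: `G` and `G'` are related by a finite sequence of
Reidemeister moves and exactly `m` 2k-moves. -/
inductive Rel2kCount (k : ℕ) : ℕ → List Endpoint → List Endpoint → Prop
  | refl (L : List Endpoint) : Rel2kCount k 0 L L
  | reid {m : ℕ} {L L' L'' : List Endpoint} :
      reidStep L L' ∨ reidStep L' L →
      Rel2kCount k m L' L'' → Rel2kCount k m L L''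
  | move {m : ℕ} {L L' L'' : List Endpoint} :
      move2k k L L' ∨ move2k k L' L →
      Rel2kCount k m L' L'' → Rel2kCount k (m + 1) L L''

/-- The 2k-move distance: the minimal number of 2k-moves needed to relate the
two diagrams (together with Reidemeister moves). -/
noncomputable def dist2k (k : ℕ) (L L' : List Endpoint) : ℕ :=
  sInf {m | Rel2kCount k m L L'}

end Gauss

namespace Gauss

/-- Total endpoint value of a word. -/
def tot (L : List Endpoint) : ℤ := (L.map endpointValue).sum

/-- Terminal minus initial occurrences of a label. -/
def bal (L : List Endpoint) (c : ℕ) : ℤ :=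
  (L.map (fun e => if e.label = c then (if e.isTerminal then (1 : ℤ) else -1) else 0)).sum

/-- The linearised index. -/
def widx : List Endpoint → ℕ → ℤ → ℤ
  | [], _, _ => 0
  | e :: L, c, a =>
    (if e.label = c then (if e.isTerminal then a else -a - endpointValue e) else 0)
      + widx L c (a + endpointValue e)

/-- Sum of signs of terminal endpoints whose weight is `n`. -/
def fsum (w : ℕ → ℤ) (n : ℤ) (L : List Endpoint) : ℤ :=
  (L.map (fun e => if e.isTerminal = true ∧ w e.label = n then signValue e else 0)).sum

@[simp] lemma tot_nil : tot [] = 0 := rfl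
@[simp] lemma tot_cons (e L) : tot (e :: L) = endpointValue e + tot L := by simp [tot]
@[simp] lemma tot_append (L M) : tot (L ++ M) = tot L + tot M := by simp [tot]
@[simp] lemma bal_nil (c) : bal [] c = 0 := rfl
@[simp] lemma bal_cons (e L c) : bal (e :: L) c =
    (if e.label = c then (if e.isTerminal then (1 : ℤ) else -1) else 0) + bal L c := by simp [bal]
@[simp] lemma bal_append (L M c) : bal (L ++ M) c = bal L c + bal M c := by simp [bal]
@[simp] lemma fsum_nil (w n) : fsum w n [] = 0 := rfl
@[simp] lemma fsum_cons (w n e L) : fsum w n (e :: L) =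
    (if e.isTerminal = true ∧ w e.label = n then signValue e else 0) + fsum w n L := by
  simp [fsum]
@[simp] lemma fsum_append (w n L M) : fsum w n (L ++ M) = fsum w n L + fsum w n M := by
  simp [fsum]
@[simp] lemma widx_nil (c a) : widx [] c a = 0 := rfl
@[simp] lemma widx_cons (e L c a) : widx (e :: L) c a =
    (if e.label = c then (if e.isTerminal then a else -a - endpointValue e) else 0)
      + widx L c (a + endpointValue e) := rfl
@[simp] lemma widx_append (L M c a) :
    widx (L ++ M) c a = widx L c a + widx M c (a + tot L) := by
  induction L generalizing a with
  | nil => simp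
  | cons e L ih => simp [ih, add_assoc]

lemma widx_shift (L c a) : widx L c a = widx L c 0 + a * bal L c := by
  induction L generalizing a with
  | nil => simp
  | cons e L ih =>
    rw [widx_cons, widx_cons, ih, ih (0 + endpointValue e), bal_cons]
    split_ifs <;> ring

lemma widx_fresh {L : List Endpoint} {c : ℕ} (h : c ∉ labels L) (a) : widx L c a = 0 := by
  induction L generalizing a with
  | nil => simp
  | cons e L ih =>
    simp only [labels, List.map_cons, List.mem_cons, not_or] at h ih
    rw [widx_cons, ih h.2, if_neg (Ne.symm h.1)]; rfl

lemma bal_fresh {L : List Endpoint} {c : ℕ} (h : c ∉ labels L) : bal L c = 0 := by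
  induction L with
  | nil => simp
  | cons e L ih =>
    simp only [labels, List.map_cons, List.mem_cons, not_or] at h ih
    rw [bal_cons, ih h.2, if_neg (Ne.symm h.1)]; rfl

lemma fsum_congr {w w' : ℕ → ℤ} {n : ℤ} {L : List Endpoint}
    (h : ∀ c ∈ labels L, w c = w' c) : fsum w n L = fsum w' n L := by
  induction L with
  | nil => simp
  | cons e L ih =>
    simp only [labels, List.map_cons, List.mem_cons, forall_eq_or_imp] at h ih
    rw [fsum_cons, fsum_cons, ih h.2, h.1]

/-- Linearised n-writhe. -/
def jw (L : List Endpoint) (n : ℤ) : ℤ := fsum (fun c => widx L c 0) n L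

def dw (L : List Endpoint) (n : ℤ) : ℤ := jw L n - jw L (-n)

def Balanced (L : List Endpoint) : Prop := tot L = 0 ∧ ∀ c, bal L c = 0

/-- A step is good. -/
def Good (L L' : List Endpoint) : Prop :=
  (Balanced L ↔ Balanced L') ∧ (Balanced L → ∀ n, dw L n = dw L' n)

lemma good_rotate {L L'} (h : rotateStep L L') : Good L L' := by
  obtain ⟨x, xs, rfl, rfl⟩ := h
  refine ⟨?_, ?_⟩
  · unfold Balanced
    simp [add_comm]
  · rintro ⟨ht, hb⟩ n
    have hw : ∀ c, widx (xs ++ [x]) c 0 = widx (x :: xs) c 0 := by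
      intro c
      have h1 := hb c
      rw [bal_cons] at h1
      rw [tot_cons] at ht
      rw [widx_append, widx_cons, widx_cons, widx_shift xs c (0 + _), widx_nil]
      have h2 : tot xs = - endpointValue x := by linarith
      rw [h2]
      by_cases hx : x.label = c
      · by_cases hx2 : x.isTerminal = true
        · simp only [hx, hx2, if_true] at h1 ⊢
          have h3 : bal xs c = -1 := by linarith
          rw [h3]; ring
        · simp only [hx, hx2, if_true] at h1 ⊢
          simp only [Bool.false_eq_true, if_false] at h1 ⊢
          have h3 : bal xs c = 1 := by linarith
          rw [h3]; ring
      · simp only [hx, if_false] at h1 ⊢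
        have h3 : bal xs c = 0 := by linarith
        rw [h3]; ring
    unfold dw jw
    simp only [hw, fsum_append, fsum_cons, fsum_nil]
    ring

lemma good_relabel {L L'} (h : relabelStep L L') : Good L L' := by
  obtain ⟨f, hf, rfl⟩ := h
  have htot : tot (L.map (fun e => Endpoint.mk (f e.label) e.isTerminal e.sign)) = tot L := by
    induction L with
    | nil => rfl
    | cons e L ih => simp [ih]; rfl
  have hbal : ∀ c, bal (L.map (fun e => Endpoint.mk (f e.label) e.isTerminal e.sign)) (f c)
      = bal L c := by
    intro c
    clear htot
    induction L with
    | nil => rfl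
    | cons e L ih => simp [ih, hf.eq_iff]
  have hw : ∀ c a, widx (L.map (fun e => Endpoint.mk (f e.label) e.isTerminal e.sign)) (f c) a
      = widx L c a := by
    intro c
    clear htot hbal
    induction L with
    | nil => intro a; rfl
    | cons e L ih => intro a; simp [ih, hf.eq_iff, endpointValue, signValue]
  have hF : ∀ (w : ℕ → ℤ) n, fsum w n (L.map (fun e => Endpoint.mk (f e.label) e.isTerminal e.sign))
      = fsum (fun c => w (f c)) n L := by
    intro w n
    clear htot hbal hw
    induction L with
    | nil => rfl
    | cons e L ih => simp [ih, signValue]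
  refine ⟨?_, ?_⟩
  · unfold Balanced
    rw [htot]
    refine and_congr_right fun _ => ⟨fun h c => ?_, fun h c => by rw [← hbal]; exact h _⟩
    by_cases hc : ∃ d, f d = c
    · obtain ⟨d, rfl⟩ := hc; rw [hbal]; exact h d
    · apply bal_fresh
      simp only [labels, List.map_map, List.mem_map, not_exists, not_and]
      intro x _ hx
      exact hc ⟨_, hx⟩
  · intro _ n
    unfold dw jw
    simp only [hF, hw]

lemma good_reid1 {L L'} (h : reid1 L L') : Good L L' := by
  obtain ⟨A, B, c, t, s, hc, rfl, rfl⟩ := h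
  have hA : c ∉ labels A := fun h => hc (by simp_all [labels])
  have hB : c ∉ labels B := fun h => hc (by simp_all [labels])
  have hv : endpointValue ⟨c, t, s⟩ + endpointValue ⟨c, !t, s⟩ = 0 := by
    cases t <;> simp [endpointValue, signValue]
  have ht : tot (A ++ [Endpoint.mk c t s, Endpoint.mk c (!t) s] ++ B) = tot (A ++ B) := by
    simp; linarith
  have hb : ∀ x, bal (A ++ [Endpoint.mk c t s, Endpoint.mk c (!t) s] ++ B) x = bal (A ++ B) x := by
    intro x; cases t <;> simp <;> split_ifs <;> simp
  refine ⟨by unfold Balanced; simp only [ht, hb], fun _ n => ?_⟩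
  have hw : ∀ x, widx (A ++ [Endpoint.mk c t s, Endpoint.mk c (!t) s] ++ B) x 0
      = widx (A ++ B) x 0 := by
    intro x
    have e1 : (tot A + (endpointValue ⟨c, t, s⟩ + endpointValue ⟨c, !t, s⟩)) = tot A := by
      rw [hv, add_zero]
    simp only [widx_append, tot_append, tot_cons, tot_nil, widx_cons, widx_nil, add_zero,
      zero_add, e1]
    cases t <;> simp [endpointValue, signValue] <;> split_ifs <;> ring
  have hwc : widx (A ++ B) c 0 = 0 := widx_fresh hc 0
  unfold dw jw
  simp only [hw, fsum_append, fsum_cons, fsum_nil, hwc, signValue]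
  have : ((0:ℤ) = -n) ↔ (0:ℤ) = n := by omega
  simp only [this]
  ring

lemma good_reid2 {L L'} (h : reid2 L L') : Good L L' := by
  obtain ⟨A, B, C, c, d, s, cr, hcd, hc, hd, rfl, rfl⟩ := h
  set Q := (if cr then [Endpoint.mk c true s, Endpoint.mk d true (!s)]
         else [Endpoint.mk d true (!s), Endpoint.mk c true s]) with hQ
  set P := [Endpoint.mk c false s, Endpoint.mk d false (!s)] with hP
  have tP : tot P = 0 := by cases s <;> simp [P, endpointValue, signValue]
  have tQ : tot Q = 0 := by cases s <;> cases cr <;> simp [Q, endpointValue, signValue]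
  have ht : tot (A ++ P ++ B ++ Q ++ C) = tot (A ++ B ++ C) := by simp [tP, tQ]
  have hb : ∀ x, bal (A ++ P ++ B ++ Q ++ C) x = bal (A ++ B ++ C) x := by
    intro x
    have : bal P x + bal Q x = 0 := by
      cases cr <;> simp [P, Q] <;> split_ifs <;> simp
    simp; linarith
  refine ⟨by unfold Balanced; simp only [ht, hb], fun _ n => ?_⟩
  have hw : ∀ x, widx (A ++ P ++ B ++ Q ++ C) x 0 = widx (A ++ B ++ C) x 0
      + (widx P x (tot A) + widx Q x (tot A + tot B)) := by
    intro x
    simp only [widx_append, tot_append, tP, tQ, add_zero, zero_add]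
    ring
  have hw1 : ∀ x ∈ labels (A ++ B ++ C),
      widx (A ++ P ++ B ++ Q ++ C) x 0 = widx (A ++ B ++ C) x 0 := by
    intro x hx
    have h1 : c ≠ x := by rintro rfl; exact hc hx
    have h2 : d ≠ x := by rintro rfl; exact hd hx
    rw [hw]
    cases cr <;> simp [P, Q, h1, h2]
  have hw2 : widx (A ++ P ++ B ++ Q ++ C) c 0 = widx (A ++ P ++ B ++ Q ++ C) d 0 := by
    rw [hw, hw, widx_fresh hc, widx_fresh hd]
    cases cr <;> cases s <;> simp [P, Q, hcd, hcd.symm, endpointValue, signValue] <;> ring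
  have hj : ∀ m, jw (A ++ P ++ B ++ Q ++ C) m = jw (A ++ B ++ C) m := by
    intro m
    unfold jw
    rw [← fsum_congr hw1]
    generalize hww : (fun x => widx (A ++ P ++ B ++ Q ++ C) x 0) = w
    have hw3 : w c = w d := by rw [← hww]; exact hw2
    have h1 : fsum w m P = 0 := by simp [P]
    have h2 : fsum w m Q = 0 := by
      cases cr <;> cases s <;> simp [Q, hw3, signValue] <;> split_ifs <;> simp
    simp only [fsum_append, h1, h2]; ring
  unfold dw
  rw [hj, hj]

lemma good_reid3 {L L'} (h : reid3 L L') : Good L L' := by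
  obtain ⟨A, B, C, D, a, b, c, s, hab, hbc, hac, rfl, rfl⟩ := h
  refine ⟨?_, fun _ n => ?_⟩
  · unfold Balanced
    refine and_congr ?_ (forall_congr' fun x => ?_)
    · simp only [tot_append, tot_cons, tot_nil]
      constructor <;> intro h <;> linarith
    · simp only [bal_append, bal_cons, bal_nil]
      constructor <;> intro h <;> linarith
  · have hw : ∀ x, widx (A ++ [Endpoint.mk b false s, Endpoint.mk a false s] ++ B ++
        [Endpoint.mk a true s, Endpoint.mk c false (!s)] ++ C ++
        [Endpoint.mk b true s, Endpoint.mk c true (!s)] ++ D) x 0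
        = widx (A ++ [Endpoint.mk a false s, Endpoint.mk b false s] ++ B ++
        [Endpoint.mk c false (!s), Endpoint.mk a true s] ++ C ++
        [Endpoint.mk c true (!s), Endpoint.mk b true s] ++ D) x 0 := by
      intro x
      cases s <;> simp [endpointValue, signValue] <;> ring_nf <;> split_ifs <;> ring
    unfold dw jw
    simp only [hw]
    simp only [fsum_append, fsum_cons, fsum_nil]
    ring

/-- first block -/
def pblk (c : ℕ → ℕ) (s : Bool) (m : ℕ) : List Endpoint :=
  (List.range m).map (fun i => Endpoint.mk (c i) (decide (i % 2 = 1)) s)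
/-- second block -/
def qblk (c : ℕ → ℕ) (s : Bool) (m : ℕ) : List Endpoint :=
  (List.range m).map (fun i => Endpoint.mk (c i) (decide (i % 2 = 0)) s)

def eps (s : Bool) : ℤ := if s then 1 else -1

lemma pblk_succ (c s m) : pblk c s (m+1) = pblk c s m ++ [⟨c m, decide (m % 2 = 1), s⟩] := by
  simp [pblk, List.range_succ]
lemma qblk_succ (c s m) : qblk c s (m+1) = qblk c s m ++ [⟨c m, decide (m % 2 = 0), s⟩] := by
  simp [qblk, List.range_succ]

lemma tot_pblk (c s m) : tot (pblk c s m) = if m % 2 = 1 then - eps s else 0 := by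
  induction m with
  | zero => simp [pblk]
  | succ m ih =>
    rw [pblk_succ, tot_append, ih]
    rcases Nat.mod_two_eq_zero_or_one m with h | h <;>
      simp [h, Nat.add_mod, endpointValue, signValue, eps]

lemma tot_qblk (c s m) : tot (qblk c s m) = if m % 2 = 1 then eps s else 0 := by
  induction m with
  | zero => simp [qblk]
  | succ m ih =>
    rw [qblk_succ, tot_append, ih]
    rcases Nat.mod_two_eq_zero_or_one m with h | h <;>
      simp [h, Nat.add_mod, endpointValue, signValue, eps]

lemma bal_blk (c s m x) : bal (pblk c s m) x + bal (qblk c s m) x = 0 := by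
  induction m with
  | zero => simp [qblk, pblk]
  | succ m ih =>
    rw [qblk_succ, pblk_succ, bal_append, bal_append]
    have : bal [⟨c m, decide (m % 2 = 1), s⟩] x + bal [⟨c m, decide (m % 2 = 0), s⟩] x = 0 := by
      rcases Nat.mod_two_eq_zero_or_one m with h | h <;> simp [h] <;> split_ifs <;> simp
    linarith

lemma widx_pblk (c s m x a) : widx (pblk c s m) x a =
    ∑ i ∈ Finset.range m, if c i = x then (if i % 2 = 1 then a - eps s else -a + eps s) else 0 := by
  induction m with
  | zero => simp [pblk]
  | succ m ih =>
    rw [pblk_succ, widx_append, ih, Finset.sum_range_succ, tot_pblk]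
    rcases Nat.mod_two_eq_zero_or_one m with h | h <;>
      simp [h, endpointValue, signValue, eps] <;> split_ifs <;> ring

lemma widx_qblk (c s m x a) : widx (qblk c s m) x a =
    ∑ i ∈ Finset.range m, if c i = x then (if i % 2 = 1 then -a else a) else 0 := by
  induction m with
  | zero => simp [qblk]
  | succ m ih =>
    rw [qblk_succ, widx_append, ih, Finset.sum_range_succ, tot_qblk]
    rcases Nat.mod_two_eq_zero_or_one m with h | h <;>
      simp [h, endpointValue, signValue, eps] <;> split_ifs <;> ring

lemma fsum_blk (c : ℕ → ℕ) (s : Bool) (w : ℕ → ℤ) (M n : ℤ) (k : ℕ)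
    (hw : ∀ i < 2 * k, w (c i) = if i % 2 = 1 then -M else M) :
    fsum w n (pblk c s (2 * k)) + fsum w n (qblk c s (2 * k)) =
      k * (eps s * ((if -M = n then 1 else 0) + (if M = n then 1 else 0))) := by
  induction k with
  | zero => simp [pblk, qblk]
  | succ k ih =>
    have ih := ih (fun i hi => hw i (by omega))
    have h0 := hw (2 * k) (by omega)
    have h1 := hw (2 * k + 1) (by omega)
    have e0 : (2 * k) % 2 = 0 := by omega
    have e1 : (2 * k + 1) % 2 = 1 := by omega
    simp only [e0, e1] at h0 h1
    simp at h0 h1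
    rw [show 2 * (k + 1) = 2 * k + 1 + 1 by ring, pblk_succ, pblk_succ, qblk_succ, qblk_succ]
    simp only [fsum_append, fsum_cons, fsum_nil, e0, e1, h0, h1, signValue]
    push_cast
    rw [add_mul, ← ih]
    simp [eps]
    split_ifs <;> ring

lemma good_move {k L L'} (h : move2k k L L') : Good L L' := by
  obtain ⟨A, B, C, c, s, hinj, hc, rfl, rfl⟩ := h
  change Good (A ++ pblk c s (2*k) ++ B ++ qblk c s (2*k) ++ C) _
  have tP : tot (pblk c s (2*k)) = 0 := by rw [tot_pblk, if_neg (by omega)]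
  have tQ : tot (qblk c s (2*k)) = 0 := by rw [tot_qblk, if_neg (by omega)]
  have hF := fsum_blk c s
  have hwP : ∀ x a, _ := widx_pblk c s (2*k)
  have hwQ : ∀ x a, _ := widx_qblk c s (2*k)
  have hbb := bal_blk c s (2*k)
  generalize hPd : pblk c s (2*k) = P at *
  generalize hQd : qblk c s (2*k) = Q at *
  have ht : tot (A ++ P ++ B ++ Q ++ C) = tot (A ++ B ++ C) := by simp [tP, tQ]
  have hb : ∀ x, bal (A ++ P ++ B ++ Q ++ C) x = bal (A ++ B ++ C) x := by
    intro x
    have := hbb x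
    simp; linarith
  refine ⟨by unfold Balanced; simp only [ht, hb], fun _ n => ?_⟩
  have hw : ∀ x, widx (A ++ P ++ B ++ Q ++ C) x 0 = widx (A ++ B ++ C) x 0
      + (widx P x (tot A) + widx Q x (tot A + tot B)) := by
    intro x
    simp only [widx_append, tot_append, tP, tQ, add_zero, zero_add]
    ring
  have hw1 : ∀ x ∈ labels (A ++ B ++ C),
      widx (A ++ P ++ B ++ Q ++ C) x 0 = widx (A ++ B ++ C) x 0 := by
    intro x hx
    rw [hw, hwP, hwQ, Finset.sum_eq_zero, Finset.sum_eq_zero]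
    · simp
    all_goals
      intro i hi
      rw [if_neg]
      rintro rfl
      exact hc i (Finset.mem_range.1 hi) hx
  have hw2 : ∀ i < 2 * k, widx (A ++ P ++ B ++ Q ++ C) (c i) 0 =
      if i % 2 = 1 then -(tot B + eps s) else tot B + eps s := by
    intro i hi
    rw [hw, hwP, hwQ, widx_fresh (hc i hi), Finset.sum_eq_single i, Finset.sum_eq_single i]
    · simp only [if_true]
      split_ifs <;> ring
    all_goals first
      | (intro j hj hji
         rw [if_neg]
         intro h
         exact hji (hinj j (Finset.mem_range.1 hj) i hi h))
      | (intro h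
         exact absurd (Finset.mem_range.2 hi) h)
  have hj : ∀ m, jw (A ++ P ++ B ++ Q ++ C) m = jw (A ++ B ++ C) m +
      k * (eps s * ((if -(tot B + eps s) = m then 1 else 0) +
        (if tot B + eps s = m then 1 else 0))) := by
    intro m
    have h3 := hF (fun x => widx (A ++ P ++ B ++ Q ++ C) x 0) (tot B + eps s) m k hw2
    rw [hPd, hQd] at h3
    rw [← h3]
    unfold jw
    rw [← fsum_congr hw1]
    simp only [fsum_append]
    ring
  unfold dw
  rw [hj, hj]
  have e1 : (-(tot B + eps s) = -n) ↔ (tot B + eps s = n) := by omega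
  have e2 : (tot B + eps s = -n) ↔ (-(tot B + eps s) = n) := by omega
  simp only [e1, e2]
  ring

lemma good_step {k L L'} (h : reidStep L L' ∨ move2k k L L') : Good L L' := by
  rcases h with (h | h | h | h | h) | h
  · exact good_rotate h
  · exact good_relabel h
  · exact good_reid1 h
  · exact good_reid2 h
  · exact good_reid3 h
  · exact good_move h

lemma good_rel {k L L'} (h : Rel2k k L L') (hL : Balanced L) :
    Balanced L' ∧ ∀ n, dw L n = dw L' n := by
  unfold Rel2k Moves at h
  induction h with
  | refl => exact ⟨hL, fun _ => rfl⟩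
  | tail _ hs ih =>
    rcases hs with hs | hs
    · have g := good_step hs
      exact ⟨g.1.1 ih.1, fun n => (ih.2 n).trans (g.2 ih.1 n)⟩
    · have g := good_step hs
      have h2 := g.1.2 ih.1
      exact ⟨h2, fun n => (ih.2 n).trans (g.2 h2 n).symm⟩

/-- Decomposition of a Gauss diagram at a chord. -/
lemma gauss_split {L : List Endpoint} (hL : IsGaussDiagram L) {e : Endpoint} (he : e ∈ L) :
    ∃ X Y Z : List Endpoint, ∃ t : Bool,
      L = X ++ ⟨e.label, t, e.sign⟩ :: (Y ++ ⟨e.label, !t, e.sign⟩ :: Z) ∧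
      e.label ∉ labels X ∧ e.label ∉ labels Y ∧ e.label ∉ labels Z := by
  obtain ⟨hlen, e', he', hl, ht, hs⟩ := hL e he
  obtain ⟨u, v, huv⟩ := List.length_eq_two.1 hlen
  have hm : e ∈ [u, v] := by rw [← huv]; simp [he]
  have hm' : e' ∈ [u, v] := by rw [← huv]; simp [he', hl]
  have hee : e ≠ e' := by rintro rfl; simp at ht
  obtain ⟨t, hu, hv⟩ : ∃ t, u = ⟨e.label, t, e.sign⟩ ∧ v = ⟨e.label, !t, e.sign⟩ := by
    cases e; cases e'
    simp only [List.mem_cons, List.not_mem_nil, or_false] at hm hm'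
    simp only at hl ht hs
    subst hl ht hs
    rcases hm with rfl | rfl <;> rcases hm' with h | h
    · exact absurd h.symm hee
    · exact ⟨_, rfl, h.symm⟩
    · exact ⟨_, h.symm, by simp⟩
    · exact absurd h.symm hee
  rw [List.filter_eq_cons_iff] at huv
  obtain ⟨X, R, rfl, hX, -, hR⟩ := huv
  rw [List.filter_eq_cons_iff] at hR
  obtain ⟨Y, Z, rfl, hY, -, hZ⟩ := hR
  rw [List.filter_eq_nil_iff] at hZ
  have aux : ∀ M : List Endpoint, (∀ a ∈ M, ¬ ((a.label == e.label) = true)) →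
      e.label ∉ labels M := by
    intro M hM h
    obtain ⟨a, ha, h2⟩ := List.mem_map.1 h
    exact hM a ha (by simp [h2])
  exact ⟨X, Y, Z, t, by rw [hu, hv], aux _ hX, aux _ hY, aux _ hZ⟩

lemma filter_fresh {M : List Endpoint} {c : ℕ} (h : c ∉ labels M) :
    M.filter (fun x => x.label == c) = [] := by
  rw [List.filter_eq_nil_iff]
  intro a ha h2
  exact h (List.mem_map.2 ⟨a, ha, by simpa using h2⟩)

lemma tot_fiber (L : List Endpoint) (S : Finset ℕ) (h : ∀ e ∈ L, e.label ∈ S) :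
    ∑ c ∈ S, tot (L.filter (fun x => x.label == c)) = tot L := by
  induction L with
  | nil => simp
  | cons e L ih =>
    have ih := ih (fun x hx => h x (List.mem_cons_of_mem _ hx))
    have : ∀ c, tot ((e :: L).filter (fun x => x.label == c)) =
        (if e.label = c then endpointValue e else 0) + tot (L.filter (fun x => x.label == c)) := by
      intro c
      by_cases hc : e.label = c <;> simp [List.filter_cons, hc]
    simp only [this, Finset.sum_add_distrib, ih, tot_cons, Finset.sum_ite_eq]
    rw [if_pos (h e (by simp))]

lemma gauss_balanced {L : List Endpoint} (hL : IsGaussDiagram L) : Balanced L := by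
  constructor
  · rw [← tot_fiber L (labels L).toFinset
      (fun e he => List.mem_toFinset.2 (List.mem_map.2 ⟨e, he, rfl⟩))]
    apply Finset.sum_eq_zero
    intro c hc
    obtain ⟨e, he, rfl⟩ := List.mem_map.1 (List.mem_toFinset.1 hc)
    obtain ⟨X, Y, Z, t, h, hX, hY, hZ⟩ := gauss_split hL he
    rw [h]
    simp only [List.filter_append, List.filter_cons, filter_fresh hX, filter_fresh hY,
      filter_fresh hZ]
    cases t <;> simp [endpointValue, signValue]
  · intro c
    by_cases hc : c ∈ labels L
    · obtain ⟨e, he, rfl⟩ := List.mem_map.1 hc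
      obtain ⟨X, Y, Z, t, h, hX, hY, hZ⟩ := gauss_split hL he
      rw [h]
      cases t <;> simp [bal_fresh hX, bal_fresh hY, bal_fresh hZ]
    · exact bal_fresh hc

lemma rotateTo_split (p : Endpoint → Bool) (X Y : List Endpoint) (e : Endpoint)
    (hX : ∀ x ∈ X, p x = false) (he : p e = true) :
    rotateTo (X ++ e :: Y) p = e :: Y ++ X := by
  have : (X ++ e :: Y).findIdx? p = some X.length := by
    rw [List.findIdx?_append, List.findIdx?_eq_none_iff.2 hX]
    simp [List.findIdx?_cons, he]
  unfold rotateTo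
  rw [this]
  simp

lemma takeWhile_split (c : ℕ) (Y Z : List Endpoint) (e : Endpoint)
    (hY : c ∉ labels Y) (he : e.label = c) :
    (Y ++ e :: Z).takeWhile (fun e => e.label != c) = Y := by
  induction Y with
  | nil => simp [he]
  | cons y Y ih =>
    simp only [labels, List.map_cons, List.mem_cons, not_or] at hY ih
    have : y.label ≠ c := Ne.symm hY.1
    simp [this, ih hY.2]

lemma chordIndex_eq {L : List Endpoint} (hL : IsGaussDiagram L) {e : Endpoint} (he : e ∈ L) :
    chordIndex L e.label = widx L e.label 0 := by
  have hb := (gauss_balanced hL).1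
  obtain ⟨X, Y, Z, t, h, hX, hY, hZ⟩ := gauss_split hL he
  have aux : ∀ M : List Endpoint, e.label ∉ labels M →
      ∀ x ∈ M, (x.label == e.label && !x.isTerminal) = false := by
    intro M hM x hx
    have : x.label ≠ e.label := fun h => hM (List.mem_map.2 ⟨x, hx, h⟩)
    simp [this]
  have hw : widx L e.label 0 = if t then - tot Y else tot Y := by
    rw [h]
    simp only [widx_append, widx_cons, widx_fresh hX, widx_fresh hY, widx_fresh hZ]
    cases t <;> simp [endpointValue, signValue] <;> ring
  rw [hw]
  unfold chordIndex
  generalize e.label = c at *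
  generalize e.sign = s at *
  subst h
  cases t
  · rw [rotateTo_split _ X _ _ (aux X hX) (by simp)]
    simp only [List.cons_append, List.drop_succ_cons, List.drop_zero, List.append_assoc]
    rw [takeWhile_split c Y _ _ hY rfl]
    simp [tot]
  · have e1 : X ++ (⟨c, true, s⟩ : Endpoint) :: (Y ++ ⟨c, !true, s⟩ :: Z)
        = (X ++ ⟨c, true, s⟩ :: Y) ++ ⟨c, !true, s⟩ :: Z := by simp
    rw [e1, rotateTo_split _ _ Z]
    · simp only [List.cons_append, List.drop_succ_cons, List.drop_zero]
      rw [← List.append_assoc, takeWhile_split c (Z ++ X) Y _ _ rfl]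
      · change tot (Z ++ X) = _
        simp [endpointValue, signValue] at hb ⊢
        linarith
      · intro h
        simp only [labels, List.map_append, List.mem_append] at h hZ hX
        tauto
    · intro x hx
      simp only [List.mem_append, List.mem_cons] at hx
      rcases hx with hx | rfl | hx
      · exact aux X hX x hx
      · simp
      · exact aux Y hY x hx
    · simp

lemma filter_sum (p : Endpoint → Bool) (f : Endpoint → ℤ) (L : List Endpoint) :
    ((L.filter p).map f).sum = (L.map (fun e => if p e = true then f e else 0)).sum := by
  induction L with
  | nil => rfl
  | cons e L ih => by_cases h : p e = true <;> simp [h, ih]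

lemma Jn_eq {L : List Endpoint} (hL : IsGaussDiagram L) (n : ℤ) : Jn L n = jw L n := by
  have : ∀ w : ℕ → ℤ, ((L.filter (fun e => e.isTerminal && decide (w e.label = n))).map
      signValue).sum = fsum w n L := by
    intro w
    rw [filter_sum]
    simp [fsum]
  unfold Jn jw
  rw [this (fun c => chordIndex L c)]
  apply fsum_congr
  intro c hc
  obtain ⟨e, he, rfl⟩ := List.mem_map.1 hc
  exact chordIndex_eq hL he

end Gauss

open Gauss in
/-- if two virtual knots are related by a finite sequence of
2k-moves (k ≥ 1), then `J_n(K) - J_n(K') = J_{-n}(K) - J_{-n}(K')` for every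
`n ≠ 0`; in particular `Σ_{n>0} |J_n(K) - J_n(K')| = Σ_{n<0} |J_n(K) - J_n(K')|`. -/
theorem jn_diff_symm_of_rel2k (k : ℕ) (hk : 0 < k)
    (G G' : List Endpoint) (hG : IsGaussDiagram G) (hG' : IsGaussDiagram G')
    (h : Rel2k k G G') :
    (∀ n : ℤ, n ≠ 0 → Jn G n - Jn G' n = Jn G (-n) - Jn G' (-n)) ∧
    ∑' n : ℕ, |(Jn G ((n : ℤ) + 1) : ℝ) - (Jn G' ((n : ℤ) + 1) : ℝ)| =
      ∑' n : ℕ, |(Jn G (-((n : ℤ) + 1)) : ℝ) - (Jn G' (-((n : ℤ) + 1)) : ℝ)| := by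
  have key : ∀ n : ℤ, Jn G n - Jn G' n = Jn G (-n) - Jn G' (-n) := by
    intro n
    have h1 := (good_rel h (gauss_balanced hG)).2 n
    unfold dw at h1
    rw [Jn_eq hG, Jn_eq hG, Jn_eq hG', Jn_eq hG']
    linarith
  refine ⟨fun n _ => key n, ?_⟩
  refine tsum_congr fun n => ?_
  have h2 := key ((n : ℤ) + 1)
  rw [← Int.cast_sub, h2, Int.cast_sub]
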